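/- Let p be a prime, R a commutative ring in which p is nilpotent, and R → R' a faithfully flat ind-étale ring homomorphism. Then the augmented Čech complex Ŵ(R) → Ŵ(R') → Ŵ(R' ⊗_R R') → ⋯ is acyclic (exact at every term). -/

import Mathlib

/-!
STATEMENT 7: Let p be a prime, R a commutative ring in which p is nilpotent, and
R → R' a faithfully flat ind-étale ring homomorphism.  Then the augmented Čech
complex Ŵ(R) → Ŵ(R') → Ŵ(R' ⊗_R R') → ⋯ is acyclic (exact at every term).
-/

open TensorProduct

universe u

/-- A bundled commutative `R`-algebra. -/
structure CommAlgebraBundle (R : Type u) [CommRing R] : Type (u + 1) where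
  carrier : Type u
  [commRing : CommRing carrier]
  [algebra : Algebra R carrier]

attribute [instance] CommAlgebraBundle.commRing CommAlgebraBundle.algebra

/-- A presentation of `R'` as a filtered colimit of étale `R`-algebras. -/
structure IndEtalePresentation (R : Type u) [CommRing R]
    (R' : Type u) [CommRing R'] [Algebra R R'] : Type (u + 1) where
  ι : Type u
  [pre : Preorder ι]
  directed : IsDirected ι (· ≤ ·)
  nonempty : Nonempty ι
  A : ι → CommAlgebraBundle R
  trans : ∀ i j : ι, i ≤ j → ((A i).carrier →ₐ[R] (A j).carrier)
  toColim : ∀ i : ι, (A i).carrier →ₐ[R] R'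
  etale : ∀ i : ι, Algebra.Etale R (A i).carrier
  trans_id : ∀ i : ι, trans i i le_rfl = AlgHom.id R (A i).carrier
  trans_comp : ∀ (i j k : ι) (hij : i ≤ j) (hjk : j ≤ k),
    (trans j k hjk).comp (trans i j hij) = trans i k (hij.trans hjk)
  toColim_comp : ∀ (i j : ι) (hij : i ≤ j), (toColim j).comp (trans i j hij) = toColim i
  jointly_surjective : ∀ x : R', ∃ (i : ι) (y : (A i).carrier), toColim i y = x
  eventually_zero : ∀ (i : ι) (y : (A i).carrier), toColim i y = 0 →
    ∃ (j : ι) (hij : i ≤ j), trans i j hij y = 0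

/-- A ring homomorphism is ind-étale if its target is a filtered colimit of étale
algebras over its source. -/
def IsIndEtale (R : Type u) [CommRing R] (R' : Type u) [CommRing R'] [Algebra R R'] : Prop :=
  Nonempty (IndEtalePresentation R R')

/-- `Ŵ(S)`: the Witt vectors all of whose coefficients are nilpotent and all but
finitely many of whose coefficients are zero. -/
def IsHatW (p : ℕ) [Fact p.Prime] {S : Type u} [CommRing S] (x : WittVector p S) : Prop :=
  (∀ n, IsNilpotent (x.coeff n)) ∧ ∃ N, ∀ n ≥ N, x.coeff n = 0

variable {R : Type u} [CommRing R]

/-- `cechAlg R' n` is the `(n+1)`-fold tensor power `R' ⊗_R ⋯ ⊗_R R'`. -/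
noncomputable def cechAlg (R' : Type u) [CommRing R'] [Algebra R R'] : ℕ → CommAlgebraBundle R
  | 0 => CommAlgebraBundle.mk R'
  | n + 1 => CommAlgebraBundle.mk ((cechAlg R' n).carrier ⊗[R] R')

/-- The `R`-algebra map inserting `1` into the `i`-th tensor position. -/
noncomputable def cechIns (R' : Type u) [CommRing R'] [Algebra R R'] :
    (n : ℕ) → Fin (n + 2) →
      ((cechAlg (R := R) R' n).carrier →ₐ[R] (cechAlg (R := R) R' (n + 1)).carrier)
  | 0, i =>
      Fin.cases Algebra.TensorProduct.includeRight
        (fun _ => Algebra.TensorProduct.includeLeft) i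
  | n + 1, i =>
      Fin.lastCases Algebra.TensorProduct.includeLeft
        (fun j => Algebra.TensorProduct.map (cechIns R' n j) (AlgHom.id R R')) i

/-- The Čech differential, the alternating sum of the maps induced by inserting `1`
into the possible tensor positions. -/
noncomputable def cechWittD (p : ℕ) [Fact p.Prime] (R' : Type u) [CommRing R'] [Algebra R R']
    (n : ℕ) :
    WittVector p (cechAlg (R := R) R' n).carrier →+
      WittVector p (cechAlg (R := R) R' (n + 1)).carrier :=
  ∑ i : Fin (n + 2),
    (-1 : ℤ) ^ (i : ℕ) •
      (WittVector.map (p := p) ((cechIns (R := R) R' n i) : _ →+* _)).toAddMonoidHom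

section etaleReduced
open Polynomial

theorem field_dvd_deriv {K : Type*} [Field K] (f q : K[X]) (hf : f ≠ 0) (N : ℕ) (h : f ∣ q ^ N) :
    f ∣ derivative f * q := by
  classical
  have h1 : UniqueFactorizationMonoid.radical f ∣ q :=
    (UniqueFactorizationMonoid.exists_dvd_pow_iff_radical_dvd hf).1 ⟨N, h⟩
  have h2 := divRadical_dvd_derivative f
  have h3 := EuclideanDomain.divRadical_mul_radical (a := f)
  calc f = _ := h3.symm
    _ ∣ _ := mul_dvd_mul h2 h1

theorem reduced_dvd_deriv {A : Type*} [CommRing A] [IsReduced A] (f q : A[X]) (hf : f.Monic)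
    (N : ℕ) (h : f ∣ q ^ N) : f ∣ derivative f * q := by
  rw [← modByMonic_eq_zero_iff_dvd hf]
  ext i
  rw [coeff_zero]
  apply IsNilpotent.eq_zero
  rw [nilpotent_iff_mem_prime]
  intro J hJ
  let φ : A →+* FractionRing (A ⧸ J) :=
    (algebraMap (A ⧸ J) (FractionRing (A ⧸ J))).comp (Ideal.Quotient.mk J)
  have h1 : (f.map φ) ∣ (derivative (f.map φ)) * q.map φ := by
    refine field_dvd_deriv _ _ (hf.map φ).ne_zero N ?_
    rw [← Polynomial.map_pow]
    exact Polynomial.map_dvd φ h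
  rw [← modByMonic_eq_zero_iff_dvd (hf.map φ), derivative_map, ← Polynomial.map_mul,
    ← map_modByMonic φ hf] at h1
  have h2 := congrArg (fun r => coeff r i) h1
  simp only [coeff_map, coeff_zero] at h2
  have h3 : algebraMap (A ⧸ J) (FractionRing (A ⧸ J))
     (Ideal.Quotient.mk J ((derivative f * q %ₘ f).coeff i)) = 0 := h2
  rw [FaithfulSMul.algebraMap_eq_zero_iff] at h3
  exact Ideal.Quotient.eq_zero_iff_mem.1 h3

theorem stdEtale_ker {A B : Type*} [CommRing A] [CommRing B] [Algebra A B]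
    (P : StandardEtalePresentation A B) (q : A[X]) (h : aeval P.x q = 0) :
    ∃ k, P.f ∣ P.g ^ k * q := by
  have h1 : (P.equivRing.trans P.P.equivAwayAdjoinRoot) (aeval P.x q) = 0 := by rw [h, map_zero]
  have h2 : (P.equivRing.trans P.P.equivAwayAdjoinRoot) P.x =
      algebraMap (AdjoinRoot P.f) _ (.root P.f) := by
    rw [AlgEquiv.trans_apply, StandardEtalePresentation.equivRing_x]
    have hm : P.P.HasMap (algebraMap (AdjoinRoot P.f)
        (Localization.Away ((AdjoinRoot.mk P.f) P.g)) (AdjoinRoot.root P.f)) := by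
      constructor
      · rw [aeval_algebraMap_apply, AdjoinRoot.aeval_eq, AdjoinRoot.mk_self, map_zero]
      · rw [aeval_algebraMap_apply, AdjoinRoot.aeval_eq]
        exact IsLocalization.Away.algebraMap_isUnit ..
    exact P.P.lift_X _ hm
  rw [← AlgEquiv.coe_toAlgHom, ← aeval_algHom_apply, AlgEquiv.coe_toAlgHom, h2, aeval_algebraMap_apply,
    AdjoinRoot.aeval_eq] at h1
  rw [IsLocalization.map_eq_zero_iff (Submonoid.powers (AdjoinRoot.mk P.f P.g))] at h1
  obtain ⟨⟨_, k, rfl⟩, h3⟩ := h1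
  refine ⟨k, ?_⟩
  rw [← AdjoinRoot.mk_eq_zero, map_mul, map_pow]
  exact h3

theorem stdEtale_reduced {A B : Type*} [CommRing A] [IsReduced A] [CommRing B] [Algebra A B]
    (P : StandardEtalePresentation A B) : IsReduced B := by
  refine ⟨fun x ⟨N, hx⟩ => ?_⟩
  obtain ⟨q, n, hq⟩ := P.exists_mul_aeval_x_g_pow_eq_aeval_x x
  have h1 : aeval P.x (q ^ (N+1)) = 0 := by
    rw [map_pow, ← hq, mul_pow, pow_succ x, hx]; simp
  obtain ⟨k, hk⟩ := stdEtale_ker P _ h1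
  have h2 : P.f ∣ (P.g ^ k * q) ^ (N+1) := by
    refine hk.trans ?_
    rw [mul_pow]
    exact mul_dvd_mul (dvd_pow_self _ (by omega)) dvd_rfl
  obtain ⟨c, hc⟩ := reduced_dvd_deriv _ _ P.monic_f _ h2
  have h3 := congrArg (aeval P.x) hc
  rw [map_mul, map_mul, map_mul, P.hasMap.1, zero_mul, IsUnit.mul_right_eq_zero, map_pow,
    IsUnit.mul_right_eq_zero, ← hq, IsUnit.mul_left_eq_zero] at h3
  · exact h3
  · exact P.hasMap.2.pow _
  · exact P.hasMap.2.pow _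
  · exact P.hasMap.isUnit_derivative_f

theorem etale_reduced {A B : Type*} [CommRing A] [IsReduced A] [CommRing B] [Algebra A B]
    [Algebra.Etale A B] : IsReduced B := by
  refine ⟨fun x hx => ?_⟩
  by_contra hne
  have hI : (LinearMap.toSpanSingleton B B x).ker ≠ ⊤ := by
    intro h
    apply hne
    have : (1 : B) ∈ (LinearMap.toSpanSingleton B B x).ker := h ▸ trivial
    simpa using this
  obtain ⟨Q, hQ, hle⟩ := Ideal.exists_le_maximal _ hI
  obtain ⟨f, hf, ⟨⟨P⟩⟩⟩ := Algebra.IsEtaleAt.exists_isStandardEtale (R := A) Q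
  have := stdEtale_reduced P
  have h1 : algebraMap B (Localization.Away f) x = 0 := (hx.map _).eq_zero
  rw [IsLocalization.map_eq_zero_iff (Submonoid.powers f)] at h1
  obtain ⟨⟨_, k, rfl⟩, h3⟩ := h1
  refine hf (hQ.isPrime.mem_of_pow_mem k (hle ?_))
  simpa using h3

end etaleReduced

section redPres

def RedPres (R : Type u) [CommRing R] (B : Type u) [CommRing B] [Algebra R B] : Prop :=
  ∀ (A : Type u) [CommRing A] [Algebra R A] [IsReduced A], IsReduced (B ⊗[R] A)

theorem RedPres.of_etale (R : Type u) [CommRing R] (B : Type u) [CommRing B] [Algebra R B]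
    [Algebra.Etale R B] : RedPres R B := by
  intro A _ _ _
  have : IsReduced (A ⊗[R] B) := etale_reduced (A := A)
  exact isReduced_of_injective (Algebra.TensorProduct.comm R B A)
    (Algebra.TensorProduct.comm R B A).injective

theorem RedPres.tensor (R : Type u) [CommRing R] (B C : Type u) [CommRing B] [Algebra R B]
    [CommRing C] [Algebra R C]
    (hB : RedPres R B) (hC : RedPres R C) : RedPres R (B ⊗[R] C) := by
  intro A _ _ _
  have := hC A
  have := hB (C ⊗[R] A)
  exact isReduced_of_injective (Algebra.TensorProduct.assoc R R R B C A)
    (Algebra.TensorProduct.assoc R R R B C A).injective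

section colim
variable {R' : Type u} [CommRing R'] [Algebra R R'] (E : IndEtalePresentation R R')
variable (A : Type u) [CommRing A] [Algebra R A]

theorem colim_zero (i : E.ι) (t : (E.A i).carrier ⊗[R] A)
    (h : LinearMap.rTensor A (E.toColim i).toLinearMap t = 0) :
    letI := E.pre
    ∃ (j : E.ι) (hij : i ≤ j), LinearMap.rTensor A (E.trans i j hij).toLinearMap t = 0 := by
  classical
  let _ := E.pre
  have := E.directed
  have := E.nonempty
  let f : ∀ i j : E.ι, i ≤ j → ((E.A i).carrier →ₗ[R] (E.A j).carrier) :=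
    fun i j h => (E.trans i j h).toLinearMap
  have : DirectedSystem (fun i => (E.A i).carrier) (fun i j h => f i j h) :=
    { map_self := fun i x => by simp [f, E.trans_id]
      map_map := fun {k j i} hij hjk x => by
        exact DFunLike.congr_fun (E.trans_comp _ _ _ hij hjk) x }
  let e : Module.DirectLimit (fun i => (E.A i).carrier) f →ₗ[R] R' :=
    Module.DirectLimit.lift R E.ι _ f (fun i => (E.toColim i).toLinearMap)
      (fun i j h x => DFunLike.congr_fun (E.toColim_comp i j h) x)
  have heof : ∀ i x, e (Module.DirectLimit.of R E.ι _ f i x) = E.toColim i x :=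
    fun i x => Module.DirectLimit.lift_of (f := f) _ _ x
  have he : Function.Bijective e := by
    constructor
    · rw [injective_iff_map_eq_zero]
      intro z hz
      obtain ⟨i, x, rfl⟩ := Module.DirectLimit.exists_of z
      rw [heof] at hz
      obtain ⟨j, hij, hj⟩ := E.eventually_zero i x hz
      rw [← Module.DirectLimit.of_f (hij := hij)]
      have : f i j hij x = 0 := hj
      rw [this, map_zero]
    · intro x
      obtain ⟨i, y, hy⟩ := E.jointly_surjective x
      exact ⟨Module.DirectLimit.of R E.ι _ f i y, by rw [heof]; exact hy⟩
  let e' := LinearEquiv.ofBijective e he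
  have h1 : LinearMap.rTensor A (Module.DirectLimit.of R E.ι _ f i) t = 0 := by
    apply (LinearEquiv.rTensor A e').injective
    rw [map_zero, ← h]
    have : (E.toColim i).toLinearMap = e ∘ₗ (Module.DirectLimit.of R E.ι _ f i) := by
      ext x; exact (heof i x).symm
    rw [this, LinearMap.rTensor_comp]
    rfl
  have h2 := TensorProduct.directLimitLeft_rTensor_of f A (i := i) t
  rw [h1, map_zero] at h2
  obtain ⟨j, hij, hj⟩ := Module.DirectLimit.of.zero_exact h2.symm
  exact ⟨j, hij, hj⟩

theorem colim_surj (t : R' ⊗[R] A) :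
    ∃ (i : E.ι) (s : (E.A i).carrier ⊗[R] A), LinearMap.rTensor A (E.toColim i).toLinearMap s = t := by
  let _ := E.pre
  have := E.directed
  have := E.nonempty
  induction t with
  | zero => exact ⟨Classical.arbitrary _, 0, map_zero _⟩
  | tmul x a =>
    obtain ⟨i, y, rfl⟩ := E.jointly_surjective x
    exact ⟨i, y ⊗ₜ a, rfl⟩
  | add x y hx hy =>
    obtain ⟨i, s, rfl⟩ := hx
    obtain ⟨j, t, rfl⟩ := hy
    obtain ⟨k, hik, hjk⟩ := directed_of (· ≤ ·) i j
    refine ⟨k, LinearMap.rTensor A (E.trans i k hik).toLinearMap s +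
      LinearMap.rTensor A (E.trans j k hjk).toLinearMap t, ?_⟩
    rw [map_add, ← LinearMap.rTensor_comp_apply, ← LinearMap.rTensor_comp_apply,
      ← AlgHom.comp_toLinearMap, ← AlgHom.comp_toLinearMap, E.toColim_comp, E.toColim_comp]

theorem RedPres.of_indEtale (E : IndEtalePresentation R R') : RedPres R R' := by
  intro A _ _ _
  refine ⟨fun x ⟨N, hx⟩ => ?_⟩
  obtain ⟨i, s, rfl⟩ := colim_surj E A x
  have h1 : LinearMap.rTensor A (E.toColim i).toLinearMap (s ^ N) = 0 := by
    rw [← hx]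
    exact map_pow (Algebra.TensorProduct.map (E.toColim i) (AlgHom.id R A)) s N
  let _ := E.pre
  obtain ⟨j, hij, hj⟩ := colim_zero E A i _ h1
  have h2 : (Algebra.TensorProduct.map (E.trans i j hij) (AlgHom.id R A) s) ^ N = 0 := by
    rw [← map_pow]; exact hj
  have := E.etale j
  have := RedPres.of_etale R (E.A j).carrier A
  have h3 : LinearMap.rTensor A (E.trans i j hij).toLinearMap s = 0 :=
    (show IsNilpotent _ from ⟨N, h2⟩).eq_zero
  rw [← E.toColim_comp i j hij, AlgHom.comp_toLinearMap, LinearMap.rTensor_comp_apply, h3, map_zero]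
end colim

theorem RedPres.cech {R' : Type u} [CommRing R'] [Algebra R R'] (h : RedPres R R') (m : ℕ) :
    RedPres R (cechAlg (R := R) R' m).carrier := by
  induction m with
  | zero => exact h
  | succ m ih => exact RedPres.tensor R _ _ ih h

theorem RedPres.nil {B : Type u} [CommRing B] [Algebra R B] (h : RedPres R B) (x : B)
    (hx : IsNilpotent x) : x ∈ (nilradical R).map (algebraMap R B) := by
  have : IsReduced (R ⧸ nilradical R) :=
    (Ideal.isRadical_iff_quotient_reduced _).1 (Ideal.radical_isRadical _)
  have := h (R ⧸ nilradical R)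
  have h1 : x ⊗ₜ[R] (1 : R ⧸ nilradical R) = 0 := by
    have := hx.map (Algebra.TensorProduct.includeLeft : B →ₐ[R] B ⊗[R] (R ⧸ nilradical R))
    exact this.eq_zero
  let φ : B ⊗[R] (R ⧸ nilradical R) →ₐ[R] B ⧸ (nilradical R).map (algebraMap R B) :=
    Algebra.TensorProduct.lift (IsScalarTower.toAlgHom R B _)
      (Ideal.Quotient.liftₐ _ (IsScalarTower.toAlgHom R R _) (by
        intro a ha
        change algebraMap R (B ⧸ _) a = 0
        rw [IsScalarTower.algebraMap_apply R B]
        exact Ideal.Quotient.eq_zero_iff_mem.2 (Ideal.mem_map_of_mem _ ha)))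
      (fun _ _ => Commute.all _ _)
  have h2 := congrArg φ h1
  rw [map_zero, Algebra.TensorProduct.lift_tmul, map_one, mul_one] at h2
  exact Ideal.Quotient.eq_zero_iff_mem.1 h2

end redPres

section wittCoeffs
open MvPolynomial

section wittHom
variable {p : ℕ} [hp : Fact p.Prime]

def wtW (p : ℕ) {idx : Type*} : idx × ℕ → ℕ := fun x => p ^ x.2

theorem wittPoly_hom {idx : Type*} (i : idx) (n : ℕ) :
    IsWeightedHomogeneous (wtW p) (rename (Prod.mk i) (wittPolynomial p ℚ n)) (p ^ n) := by
  rw [wittPolynomial_eq_sum_C_mul_X_pow, map_sum]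
  refine IsWeightedHomogeneous.sum _ _ _ fun j hj => ?_
  rw [map_mul, rename_C, map_pow (rename (Prod.mk i)), rename_X]
  have h1 := ((isWeightedHomogeneous_X ℚ (wtW p) ((i, j) : idx × ℕ)).pow (p ^ (n - j)))
  have h2 := (isWeightedHomogeneous_C (wtW p (idx := idx)) ((p : ℚ)^j)).mul h1
  have h3 : 0 + p ^ (n - j) • wtW p (i, j) = p ^ n := by
    simp only [wtW, zero_add, smul_eq_mul]
    rw [← pow_add]
    congr 1
    have := Finset.mem_range.1 hj
    omega
  rw [h3] at h2
  exact h2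

theorem wittStructRat_hom {idx : Type*} (Φ : MvPolynomial idx ℚ)
    (hΦ : ∀ n, IsWeightedHomogeneous (wtW p)
      (bind₁ (fun i => rename (Prod.mk i) (wittPolynomial p ℚ n)) Φ) (p ^ n)) (n : ℕ) :
    IsWeightedHomogeneous (wtW p) (wittStructureRat p Φ n) (p ^ n) := by
  induction n using Nat.strong_induction_on with
  | _ n ih =>
  rw [wittStructureRat_rec]
  rw [show p ^ n = 0 + p ^ n by simp]
  refine (isWeightedHomogeneous_C _ _).mul ?_
  refine Submodule.sub_mem (weightedHomogeneousSubmodule ℚ (wtW p) (p ^ n)) (hΦ n) ?_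
  refine IsWeightedHomogeneous.sum _ _ _ fun j hj => ?_
  have hj' := Finset.mem_range.1 hj
  have h2 := (isWeightedHomogeneous_C (wtW p (idx := idx)) ((p : ℚ)^j)).mul
    ((ih j hj').pow (p ^ (n - j)))
  convert h2 using 1
  rw [zero_add, smul_eq_mul, ← pow_add]
  congr 1
  omega

theorem wittStructInt_hom {idx : Type*} (Φ : MvPolynomial idx ℤ)
    (hΦ : ∀ n, IsWeightedHomogeneous (wtW p)
      (bind₁ (fun i => rename (Prod.mk i) (wittPolynomial p ℚ n)) (map (Int.castRingHom ℚ) Φ))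
        (p ^ n)) (n : ℕ) :
    IsWeightedHomogeneous (wtW p) (wittStructureInt p Φ n) (p ^ n) := by
  have := wittStructRat_hom _ hΦ n
  rw [← map_wittStructureInt] at this
  intro d hd
  apply this
  rw [coeff_map]
  simpa using hd

theorem wittAdd_hom (n : ℕ) :
    IsWeightedHomogeneous (wtW p) (WittVector.wittAdd p n) (p ^ n) := by
  refine wittStructInt_hom _ (fun n => ?_) n
  simp only [map_add, map_X, bind₁_X_right]
  exact (wittPoly_hom _ n).add (wittPoly_hom _ n)

theorem wittSub_hom (n : ℕ) :
    IsWeightedHomogeneous (wtW p) (WittVector.wittSub p n) (p ^ n) := by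
  refine wittStructInt_hom _ (fun n => ?_) n
  simp only [map_sub, map_X, bind₁_X_right]
  exact Submodule.sub_mem (weightedHomogeneousSubmodule ℚ (wtW p) (p ^ n))
    (wittPoly_hom _ n) (wittPoly_hom _ n)

variable {S : Type*} [CommRing S]

theorem monom_mem {σ : Type*} (J : Ideal S) (v : σ → S) (hv : ∀ i, v i ∈ J) (d : σ →₀ ℕ) (M : ℕ)
    (hM : M ≤ ∑ i ∈ d.support, d i) : ∏ i ∈ d.support, v i ^ d i ∈ J ^ M := by
  have h := Ideal.prod_mem_prod (s := d.support) (I := fun i => J ^ d i)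
    (x := fun i => v i ^ d i) (fun i _ => Ideal.pow_mem_pow (hv i) _)
  rw [Finset.prod_pow_eq_pow_sum] at h
  exact Ideal.pow_le_pow_right hM h

theorem wt_eq {idx : Type*} {φ : MvPolynomial (idx × ℕ) ℤ} {n : ℕ}
    (hφ : IsWeightedHomogeneous (wtW p) φ (p ^ n)) {d : idx × ℕ →₀ ℕ} (hd : d ∈ φ.support) :
    ∑ i ∈ d.support, d i * p ^ i.2 = p ^ n := by
  have := hφ (mem_support_iff.1 hd)
  rw [Finsupp.weight_apply] at this
  simpa [Finsupp.sum, wtW] using this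

theorem hom_vanish {idx : Type*} (φ : MvPolynomial (idx × ℕ) ℤ) (n : ℕ)
    (hφ : IsWeightedHomogeneous (wtW p) φ (p ^ n)) (J : Ideal S) (M N : ℕ) (hJ : J ^ M = ⊥)
    (v : idx × ℕ → S) (hv : ∀ i, v i ∈ J) (hN : ∀ i, N ≤ i.2 → v i = 0) (hn : N + M ≤ n) :
    aeval v φ = 0 := by
  rw [aeval_def, eval₂_eq]
  refine Finset.sum_eq_zero fun d hd => ?_
  have hw := wt_eq hφ hd
  by_cases h : ∃ i ∈ d.support, N ≤ i.2
  · obtain ⟨i, hi, hiN⟩ := h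
    rw [Finset.prod_eq_zero hi, mul_zero]
    rw [hN i hiN, zero_pow (Finsupp.mem_support_iff.1 hi)]
  · push Not at h
    have h1 : p ^ n ≤ (∑ i ∈ d.support, d i) * p ^ N := by
      rw [← hw, Finset.sum_mul]
      exact Finset.sum_le_sum fun i hi => Nat.mul_le_mul_left _
        (Nat.pow_le_pow_right hp.out.pos (h i hi).le)
    have h2 : p ^ M * p ^ N ≤ p ^ n := by
      rw [← pow_add]; exact Nat.pow_le_pow_right hp.out.pos (by omega)
    have h3 := Nat.le_of_mul_le_mul_right (h2.trans h1) (pow_pos hp.out.pos N)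
    have h4 := monom_mem J v hv d M ((Nat.lt_pow_self hp.out.one_lt).le.trans h3)
    rw [hJ] at h4
    rw [Ideal.mem_bot.1 h4, mul_zero]

theorem hom_linear (φ : MvPolynomial (Fin 2 × ℕ) ℤ) (n : ℕ)
    (hφ : IsWeightedHomogeneous (wtW p) φ (p ^ n)) (J : Ideal S) (hJ : J ^ 2 = ⊥)
    (v : Fin 2 × ℕ → S) (hv : ∀ i, v i ∈ J) :
    aeval v φ = (coeff (Finsupp.single (0, n) 1) φ : ℤ) * v (0, n) +
      (coeff (Finsupp.single (1, n) 1) φ : ℤ) * v (1, n) := by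
  classical
  have hne : (Finsupp.single ((0 : Fin 2), n) 1 : Fin 2 × ℕ →₀ ℕ) ≠ Finsupp.single (1, n) 1 := by
    intro h
    have := (Finsupp.single_left_inj one_ne_zero).1 h
    simp at this
  rw [aeval_def, eval₂_eq, Finset.sum_subset (Finset.subset_union_left
    (s₂ := {Finsupp.single (0, n) 1, Finsupp.single (1, n) 1})),
    ← Finset.sum_subset (Finset.subset_union_right), Finset.sum_pair hne]
  · simp [Finsupp.support_single]
  · intro d hd hd'
    by_cases hds : d ∈ φ.support
    swap
    · rw [notMem_support_iff.1 hds]; simp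
    have hw := wt_eq hφ hds
    by_cases h2 : 2 ≤ ∑ i ∈ d.support, d i
    · have h4 := monom_mem J v hv d 2 h2
      rw [hJ] at h4
      rw [Ideal.mem_bot.1 h4, mul_zero]
    exfalso
    have hpn : 0 < p ^ n := pow_pos hp.out.pos n
    have hdne : d.support.Nonempty := by
      rw [Finset.nonempty_iff_ne_empty]
      intro h
      rw [h] at hw
      simp at hw
      omega
    obtain ⟨i, hi⟩ := hdne
    have hdi : d i ≠ 0 := Finsupp.mem_support_iff.1 hi
    have hsum := Finset.add_sum_erase d.support (fun i => d i) hi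
    have hd1 : d i = 1 := by omega
    have hrest : ∀ j ∈ d.support.erase i, d j = 0 := by
      rw [← Finset.sum_eq_zero_iff]; omega
    have hds : d = Finsupp.single i 1 := by
      ext j
      by_cases hji : j = i
      · subst hji; simp [hd1]
      · rw [Finsupp.single_eq_of_ne hji]
        by_contra hj
        exact hj (hrest j (Finset.mem_erase.2 ⟨hji, Finsupp.mem_support_iff.2 hj⟩))
    rw [hds] at hw hd'
    rw [Finsupp.support_single _ one_ne_zero] at hw
    simp at hw
    have hin : i.2 = n := Nat.pow_right_injective hp.out.two_le hw
    apply hd'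
    obtain ⟨b, i⟩ := i
    simp at hin
    subst hin
    fin_cases b <;> simp
  · intro d _ hd
    rw [notMem_support_iff.1 hd]; simp

open WittVector in
theorem witt_add_linear (J : Ideal S) (hJ : J ^ 2 = ⊥) (x y : WittVector p S)
    (hx : ∀ n, x.coeff n ∈ J) (hy : ∀ n, y.coeff n ∈ J) (n : ℕ) :
    (x + y).coeff n = x.coeff n + y.coeff n := by
  have key : ∀ x y : WittVector p S, (∀ n, x.coeff n ∈ J) → (∀ n, y.coeff n ∈ J) →
      (x + y).coeff n = (coeff (Finsupp.single (0, n) 1) (wittAdd p n) : ℤ) * x.coeff n +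
      (coeff (Finsupp.single (1, n) 1) (wittAdd p n) : ℤ) * y.coeff n := by
    intro x y hx hy
    rw [WittVector.add_coeff, peval, hom_linear _ n (wittAdd_hom n) J hJ]
    · rfl
    · rintro ⟨b, i⟩
      fin_cases b
      · exact hx i
      · exact hy i
  have h0 : ∀ n, (0 : WittVector p S).coeff n ∈ J := by intro n; simp
  have h1 := key x 0 hx h0
  have h2 := key 0 y h0 hy
  simp only [add_zero, zero_add, WittVector.zero_coeff, mul_zero] at h1 h2
  rw [key x y hx hy, ← h1, ← h2]

open WittVector in
theorem witt_sub_fin (J : Ideal S) (M N : ℕ) (hJ : J ^ M = ⊥) (x y : WittVector p S)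
    (hx : ∀ n, x.coeff n ∈ J) (hy : ∀ n, y.coeff n ∈ J)
    (hxN : ∀ n, N ≤ n → x.coeff n = 0) (hyN : ∀ n, N ≤ n → y.coeff n = 0)
    (n : ℕ) (hn : N + M ≤ n) :
    (x - y).coeff n = 0 := by
  rw [WittVector.sub_coeff, peval]
  refine hom_vanish _ n (wittSub_hom n) J M N hJ _ ?_ ?_ hn
  · rintro ⟨b, i⟩
    fin_cases b
    · exact hx i
    · exact hy i
  · rintro ⟨b, i⟩ hi
    fin_cases b
    · exact hxN i hi
    · exact hyN i hi

/-- Witt vectors with coefficients in an ideal `J`. -/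
noncomputable def wIdeal (p : ℕ) [Fact p.Prime] (J : Ideal S) : AddSubgroup (WittVector p S) :=
  (WittVector.map (p := p) (Ideal.Quotient.mk J)).toAddMonoidHom.ker

theorem mem_wIdeal (J : Ideal S) (x : WittVector p S) :
    x ∈ wIdeal p J ↔ ∀ n, x.coeff n ∈ J := by
  rw [wIdeal, AddMonoidHom.mem_ker]
  change WittVector.map _ x = 0 ↔ _
  rw [WittVector.ext_iff]
  simp [WittVector.map_coeff, Ideal.Quotient.eq_zero_iff_mem]

/-- Finitely supported Witt vectors with coefficients in a nilpotent ideal `J`. -/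
noncomputable def hIdeal (p : ℕ) [Fact p.Prime] (J : Ideal S) (M : ℕ) (hJ : J ^ M = ⊥) :
    AddSubgroup (WittVector p S) :=
  AddSubgroup.ofSub {x | x ∈ wIdeal p J ∧ ∃ N, ∀ n ≥ N, x.coeff n = 0}
    ⟨0, zero_mem _, 0, by simp⟩ (by
      rintro x ⟨hx, N, hN⟩ y ⟨hy, N', hN'⟩
      rw [← sub_eq_add_neg]
      refine ⟨sub_mem hx hy, max N N' + M, ?_⟩
      exact witt_sub_fin J M (max N N') hJ x y ((mem_wIdeal J x).1 hx) ((mem_wIdeal J y).1 hy)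
        (fun n hn => hN n (le_of_max_le_left hn)) (fun n hn => hN' n (le_of_max_le_right hn)))

theorem mem_hIdeal (J : Ideal S) (M : ℕ) (hJ : J ^ M = ⊥) (x : WittVector p S) :
    x ∈ hIdeal p J M hJ ↔ (∀ n, x.coeff n ∈ J) ∧ ∃ N, ∀ n ≥ N, x.coeff n = 0 := by
  rw [← mem_wIdeal]; rfl

/-- `n`-th coefficient modulo `K`, additive on `W(J)` if `J ^ 2 ≤ K`. -/
noncomputable def coeffHom (p : ℕ) [Fact p.Prime] (J K : Ideal S) (h : J ^ 2 ≤ K) (n : ℕ) :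
    wIdeal p J →+ S ⧸ K :=
  AddMonoidHom.mk' (fun x => Ideal.Quotient.mk K (x.1.coeff n)) (by
    rintro ⟨x, hx⟩ ⟨y, hy⟩
    have := witt_add_linear (J.map (Ideal.Quotient.mk K)) (by
        rw [← Ideal.map_pow, ← le_bot_iff, Ideal.map_le_iff_le_comap, ← RingHom.ker,
          Ideal.mk_ker]
        exact h) (WittVector.map (Ideal.Quotient.mk K) x) (WittVector.map (Ideal.Quotient.mk K) y)
        (fun n => Ideal.mem_map_of_mem _ ((mem_wIdeal J x).1 hx n))
        (fun n => Ideal.mem_map_of_mem _ ((mem_wIdeal J y).1 hy n)) n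
    rw [← map_add] at this
    exact this)

end wittHom

end wittCoeffs

section exactness
variable {R : Type u} [CommRing R]

theorem exact_of_homotopy (R' : Type u) [CommRing R'] [Algebra R R'] [Module.FaithfullyFlat R R']
    {A B C : Type u} [AddCommGroup A] [AddCommGroup B] [AddCommGroup C] [Module R A] [Module R B]
    [Module R C] (a : A →ₗ[R] B) (b : B →ₗ[R] C) (hba : b ∘ₗ a = 0)
    (hB : B ⊗[R] R' →ₗ[R] A ⊗[R] R') (hC : C ⊗[R] R' →ₗ[R] B ⊗[R] R') (ε : R) (hε : ε * ε = 1)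
    (H : hC ∘ₗ b.rTensor R' = ε • LinearMap.id + a.rTensor R' ∘ₗ hB)
    (M : Type u) [AddCommGroup M] [Module R M] :
    Function.Exact (a.lTensor M) (b.lTensor M) := by
  apply Module.FaithfullyFlat.rTensor_reflects_exact R R'
  intro t
  constructor
  · intro ht
    let t' := TensorProduct.assoc R M B R' t
    have h1 : LinearMap.lTensor M (b.rTensor R') t' = 0 := by
      have := DFunLike.congr_fun (LinearMap.lTensor_rTensor_comp_assoc (P := M) (Q := R') B b) t
      simp only [LinearMap.comp_apply, LinearEquiv.coe_coe] at this
      rw [this, ht, map_zero]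
    have h2 : ε • t' + LinearMap.lTensor M (a.rTensor R') (LinearMap.lTensor M hB t') = 0 := by
      have := congrArg (LinearMap.lTensor M) H
      rw [LinearMap.lTensor_comp, LinearMap.lTensor_add, LinearMap.lTensor_comp] at this
      have h3 := DFunLike.congr_fun this t'
      rw [LinearMap.comp_apply, h1, map_zero] at h3
      rw [h3, LinearMap.add_apply, LinearMap.comp_apply]
      congr 1
      have h4 : LinearMap.lTensor M (ε • (LinearMap.id : B ⊗[R] R' →ₗ[R] B ⊗[R] R')) =
          ε • LinearMap.id := by
        rw [LinearMap.lTensor_smul, LinearMap.lTensor_id]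
      rw [h4]; rfl
    have h5 : t' = LinearMap.lTensor M (a.rTensor R') (LinearMap.lTensor M hB (-ε • t')) := by
      rw [map_smul, map_smul]
      have h6 := congrArg (fun z => ε • z) h2
      simp only [smul_add, smul_smul, hε, one_smul, smul_zero] at h6
      rw [neg_smul]
      exact eq_neg_of_add_eq_zero_left h6
    refine ⟨(TensorProduct.assoc R M A R').symm (LinearMap.lTensor M hB (-ε • t')), ?_⟩
    have := DFunLike.congr_fun (LinearMap.rTensor_lTensor_comp_assoc_symm (P := M) (Q := R') A a)
      (LinearMap.lTensor M hB (-ε • t'))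
    simp only [LinearMap.comp_apply, LinearEquiv.coe_coe] at this
    rw [this, ← h5]
    simp [t']
  · rintro ⟨s, rfl⟩
    rw [← LinearMap.rTensor_comp_apply, ← LinearMap.lTensor_comp, hba]
    simp

/-- multiplication of the last two tensor factors -/
noncomputable def mulR (R' : Type u) [CommRing R'] [Algebra R R'] (B : Type u) [AddCommGroup B]
    [Module R B] : (B ⊗[R] R') ⊗[R] R' →ₗ[R] B ⊗[R] R' :=
  LinearMap.lTensor B (LinearMap.mul' R R') ∘ₗ (TensorProduct.assoc R B R' R').toLinearMap

theorem exact_succ (R' : Type u) [CommRing R'] [Algebra R R'] [Module.FaithfullyFlat R R']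
    {A : Type u} [AddCommGroup A] [Module R A] (a : A →ₗ[R] A ⊗[R] R')
    (b : A ⊗[R] R' →ₗ[R] (A ⊗[R] R') ⊗[R] R') (ε : R) (hε : ε * ε = 1)
    (hb : b = a.rTensor R' + ε • (TensorProduct.mk R (A ⊗[R] R') R').flip 1)
    (hba : b ∘ₗ a = 0) (M : Type u) [AddCommGroup M] [Module R M] :
    Function.Exact (a.lTensor M) (b.lTensor M) := by
  refine exact_of_homotopy R' a b hba (mulR R' A) (mulR R' (A ⊗[R] R')) ε hε ?_ M
  subst hb
  apply TensorProduct.ext'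
  intro x y
  simp only [LinearMap.comp_apply, LinearMap.rTensor_tmul, LinearMap.add_apply,
    LinearMap.smul_apply, TensorProduct.add_tmul, map_add, LinearMap.flip_apply, mk_apply,
    ← TensorProduct.smul_tmul', map_smul, LinearMap.id_apply]
  rw [add_comm]
  congr 1
  · simp [mulR]
  · induction x with
    | zero => simp
    | add x y hx hy => simp only [map_add, TensorProduct.add_tmul, hx, hy]
    | tmul x z => simp [mulR]

theorem exact_zero (R' : Type u) [CommRing R'] [Algebra R R'] [Module.FaithfullyFlat R R']
    (b : R' →ₗ[R] R' ⊗[R] R') (hb : ∀ x, b x = 1 ⊗ₜ x - x ⊗ₜ 1)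
    (M : Type u) [AddCommGroup M] [Module R M] :
    Function.Exact ((Algebra.linearMap R R').lTensor M) (b.lTensor M) := by
  refine exact_of_homotopy R' _ b ?_ ((TensorProduct.lid R R').symm.toLinearMap ∘ₗ
    (LinearMap.mul' R R')) (mulR R' R') (-1) (by norm_num) ?_ M
  · ext; simp [hb]
  · apply TensorProduct.ext'
    intro x y
    simp [hb, mulR, TensorProduct.sub_tmul]
    abel

noncomputable def muI (I : Ideal R) (B : Type u) [AddCommGroup B] [Module R B] :
    I ⊗[R] B →ₗ[R] B :=
  TensorProduct.lift ((LinearMap.lsmul R B).comp I.subtype)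

theorem muI_tmul (I : Ideal R) (B : Type u) [AddCommGroup B] [Module R B] (i : I) (x : B) :
   muI I B (i ⊗ₜ x) = (i : R) • x := rfl

theorem muI_range (I : Ideal R) (B : Type u) [AddCommGroup B] [Module R B] (z : B) :
    z ∈ I • (⊤ : Submodule R B) ↔ ∃ t, muI I B t = z := by
  constructor
  · intro h
    refine Submodule.smul_induction_on h ?_ ?_
    · intro r hr x _
      exact ⟨(⟨r, hr⟩ : I) ⊗ₜ x, rfl⟩
    · rintro _ _ ⟨s, rfl⟩ ⟨t, rfl⟩
      exact ⟨s + t, map_add _ _ _⟩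
  · rintro ⟨t, rfl⟩
    induction t with
    | zero => simp
    | add x y hx hy => rw [map_add]; exact add_mem hx hy
    | tmul i x => exact Submodule.smul_mem_smul i.2 trivial

theorem muI_inj (I : Ideal R) (B : Type u) [AddCommGroup B] [Module R B] [Module.Flat R B] :
    Function.Injective (muI I B) := by
  have h : muI I B = (TensorProduct.lid R B).toLinearMap ∘ₗ I.subtype.rTensor B := by
    apply TensorProduct.ext'
    intro x y
    simp [muI_tmul]
  rw [h, LinearMap.coe_comp]
  exact (TensorProduct.lid R B).injective.comp
    (Module.Flat.rTensor_preserves_injective_linearMap _ Subtype.val_injective)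

theorem muI_nat (I : Ideal R) {B C : Type u} [AddCommGroup B] [Module R B] [AddCommGroup C]
    [Module R C] (f : B →ₗ[R] C) (t : I ⊗[R] B) :
    muI I C (f.lTensor I t) = f (muI I B t) := by
  induction t with
  | zero => simp
  | add x y hx hy => simp only [map_add, hx, hy]
  | tmul i x => simp [muI_tmul]

theorem muI_incl {I J : Ideal R} (h : J ≤ I) {B : Type u} [AddCommGroup B] [Module R B]
    (t : J ⊗[R] B) :
    muI I B ((Submodule.inclusion h).rTensor B t) = muI J B t := by
  induction t with
  | zero => simp
  | add x y hx hy => simp only [map_add, hx, hy]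
  | tmul i x => simp [muI_tmul]

theorem flat_step {A B C : Type u} [AddCommGroup A] [AddCommGroup B] [AddCommGroup C] [Module R A]
    [Module R B] [Module R C] [Module.Flat R B] [Module.Flat R C] (a : A →ₗ[R] B) (b : B →ₗ[R] C)
    (hex : ∀ (M : Type u) [AddCommGroup M] [Module R M],
      Function.Exact (a.lTensor M) (b.lTensor M))
    (I J : Ideal R) (h : J ≤ I) (z : B) (hz : z ∈ I • (⊤ : Submodule R B))
    (hbz : b z ∈ J • (⊤ : Submodule R C)) :
    ∃ y ∈ I • (⊤ : Submodule R A), z - a y ∈ J • (⊤ : Submodule R B) := by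
  obtain ⟨t, rfl⟩ := (muI_range I B z).1 hz
  obtain ⟨w, hw⟩ := (muI_range J C _).1 hbz
  let inc := Submodule.inclusion h
  let q := (LinearMap.range inc).mkQ
  have hq : Function.Exact inc q := by
    rw [LinearMap.exact_iff]; simp [q]
  have hqs : Function.Surjective q := Submodule.mkQ_surjective _
  have h1 : b.lTensor I t = inc.rTensor C w := by
    apply muI_inj
    rw [muI_nat, muI_incl, hw]
  have h2 : b.lTensor _ (q.rTensor B t) = 0 := by
    have : b.lTensor _ (q.rTensor B t) = q.rTensor C (b.lTensor I t) := by
      rw [← LinearMap.comp_apply, ← LinearMap.comp_apply, LinearMap.lTensor_comp_rTensor,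
        LinearMap.rTensor_comp_lTensor]
    rw [this, h1]
    exact (rTensor_exact C hq hqs).apply_apply_eq_zero w
  obtain ⟨y', hy'⟩ := (hex _ _).1 h2
  obtain ⟨y, rfl⟩ := LinearMap.rTensor_surjective A hqs y'
  have h3 : q.rTensor B (t - a.lTensor I y) = 0 := by
    rw [map_sub, ← hy', sub_eq_zero, ← LinearMap.comp_apply, ← LinearMap.comp_apply,
      LinearMap.lTensor_comp_rTensor, LinearMap.rTensor_comp_lTensor]
  obtain ⟨s, hs⟩ := (rTensor_exact B hq hqs _).1 h3
  refine ⟨muI I A y, (muI_range I A _).2 ⟨y, rfl⟩, (muI_range J B _).2 ⟨s, ?_⟩⟩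
  rw [← muI_incl h, hs, map_sub, muI_nat]
end exactness

section cosimp

theorem alt_sum_zero {C : Type*} [AddCommGroup C] (n : ℕ) (T : Fin (n + 2) → Fin (n + 3) → C)
    (hT : ∀ i j : Fin (n + 2), i ≤ j → T i j.succ = T j i.castSucc) :
    ∑ i : Fin (n + 2), ∑ j : Fin (n + 3), ((-1 : ℤ) ^ (i : ℕ) * (-1 : ℤ) ^ (j : ℕ)) • T i j = 0 := by
  simp only [← Finset.sum_product']
  let P := Fin (n + 2) × Fin (n + 3)
  let S : Finset P := {ij : P | (ij.2 : ℕ) ≤ (ij.1 : ℕ)}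
  rw [Finset.univ_product_univ, ← Finset.sum_add_sum_compl S, ← eq_neg_iff_add_eq_zero,
    ← Finset.sum_neg_distrib]
  let φ : ∀ ij : P, ij ∈ S → P := fun ij hij =>
    (Fin.castLT ij.2 (lt_of_le_of_lt (Finset.mem_filter.mp hij).right (Fin.is_lt ij.1)), ij.1.succ)
  apply Finset.sum_bij φ
  · intro ij hij
    simp_rw [S, φ, Finset.compl_filter, Finset.mem_filter_univ, Fin.val_succ,
      Fin.val_castLT] at hij ⊢
    lia
  · rintro ⟨i, j⟩ hij ⟨i', j'⟩ hij' h
    rw [Prod.mk_inj]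
    exact ⟨by simpa [φ] using! congr_arg Prod.snd h,
      by simpa [φ, Fin.castSucc_castLT] using! congr_arg Fin.castSucc (congr_arg Prod.fst h)⟩
  · rintro ⟨i', j'⟩ hij'
    simp_rw [S, Finset.compl_filter, Finset.mem_filter_univ, not_le] at hij'
    refine ⟨(j'.pred <| ?_, Fin.castSucc i'), ?_, ?_⟩
    · rintro rfl
      simp only [Fin.val_zero, not_lt_zero] at hij'
    · simpa [S] using! Nat.le_sub_one_of_lt hij'
    · simp only [φ, Fin.castLT_castSucc, Fin.succ_pred]
  · rintro ⟨i, j⟩ hij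
    have hji : (j : ℕ) ≤ i := (Finset.mem_filter.mp hij).right
    have h := hT (Fin.castLT j (lt_of_le_of_lt hji (Fin.is_lt i))) i hji
    rw [Fin.castSucc_castLT] at h
    simp only [φ]
    rw [h, ← neg_smul]
    congr 1
    simp only [Fin.val_succ, pow_add, pow_one, mul_neg, neg_neg, mul_one, Fin.val_castLT]
    apply mul_comm

theorem alt_comp_zero {A B C : Type*} [AddCommGroup A] [AddCommGroup B] [AddCommGroup C] (n : ℕ)
    (f : Fin (n + 2) → A →+ B) (g : Fin (n + 3) → B →+ C)
    (h : ∀ i j : Fin (n + 2), i ≤ j → ∀ x, g j.succ (f i x) = g i.castSucc (f j x)) (x : A) :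
    (∑ j : Fin (n + 3), (-1 : ℤ) ^ (j : ℕ) • g j) ((∑ i : Fin (n + 2), (-1 : ℤ) ^ (i : ℕ) • f i) x)
      = 0 := by
  rw [← alt_sum_zero n (fun i j => g j (f i x)) (fun i j hij => h i j hij x)]
  simp only [AddMonoidHom.finsetSum_apply, AddMonoidHom.coe_smul, Pi.smul_apply, map_sum, map_zsmul, smul_smul,
    Finset.smul_sum]

variable {R : Type u} [CommRing R] (R' : Type u) [CommRing R'] [Algebra R R']

theorem cechIns_last (n : ℕ) : cechIns (R := R) R' (n + 1) (Fin.last _) =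
    (Algebra.TensorProduct.includeLeft : (cechAlg (R := R) R' n.succ).carrier →ₐ[R]
      (cechAlg (R := R) R' n.succ).carrier ⊗[R] R') := by
  rw [cechIns]; exact Fin.lastCases_last

theorem cechIns_castSucc (n : ℕ) (j : Fin (n + 2)) : cechIns (R := R) R' (n + 1) j.castSucc =
    Algebra.TensorProduct.map (cechIns (R := R) R' n j) (AlgHom.id R R') := by
  rw [cechIns]; exact Fin.lastCases_castSucc _

theorem cechIns_last_gen (n : ℕ) : cechIns (R := R) R' n (Fin.last _) =
    (Algebra.TensorProduct.includeLeft : (cechAlg (R := R) R' n).carrier →ₐ[R]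
      (cechAlg (R := R) R' n).carrier ⊗[R] R') := by
  cases n with
  | zero => rfl
  | succ n => exact cechIns_last R' n

theorem cechIns_cosimp (n : ℕ) (i j : Fin (n + 2)) (hij : i ≤ j) :
    (cechIns (R := R) R' (n + 1) j.succ).comp (cechIns R' n i) =
      (cechIns R' (n + 1) i.castSucc).comp (cechIns R' n j) := by
  induction n with
  | zero =>
    rw [cechIns_castSucc]
    induction j using Fin.lastCases with
    | last =>
      rw [Fin.succ_last, cechIns_last, cechIns_last_gen]
      ext x
      change (cechIns R' 0 i x) ⊗ₜ[R] (1 : R') = (cechIns R' 0 i x) ⊗ₜ[R] (1 : R')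
      rfl
    | cast j =>
      have hj : j = 0 := Subsingleton.elim _ _
      subst hj
      have hi : i = 0 := le_antisymm hij (Fin.zero_le _)
      subst hi
      rw [Fin.succ_castSucc, cechIns_castSucc]
      ext x
      change ((1 : R') ⊗ₜ[R] (1 : R')) ⊗ₜ[R] x = ((1 : R' ⊗[R] R')) ⊗ₜ[R] x
      rfl
  | succ n ih =>
    rw [cechIns_castSucc]
    induction j using Fin.lastCases with
    | last =>
      rw [Fin.succ_last, cechIns_last, cechIns_last_gen]
      apply AlgHom.ext
      intro x
      change (cechIns R' (n+1) i x) ⊗ₜ[R] (1 : R') = (cechIns R' (n+1) i x) ⊗ₜ[R] (1 : R')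
      rfl
    | cast j =>
      induction i using Fin.lastCases with
      | last => exact absurd hij (not_le.2 (Fin.castSucc_lt_last j))
      | cast i =>
        rw [Fin.succ_castSucc, cechIns_castSucc R' (n + 1) j.succ, cechIns_castSucc R' n i,
          cechIns_castSucc R' n j]
        have := ih i j hij
        rw [cechIns_castSucc] at this
        apply Algebra.TensorProduct.ext'
        intro x y
        exact congrArg (fun z => z ⊗ₜ[R] y) (DFunLike.congr_fun this x)

/-- The linear Čech differential. -/
noncomputable def cechLinD (n : ℕ) :
    (cechAlg (R := R) R' n).carrier →ₗ[R] (cechAlg (R := R) R' (n + 1)).carrier :=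
  ∑ i : Fin (n + 2), ((-1 : R) ^ (i : ℕ)) • (cechIns (R := R) R' n i).toLinearMap

theorem cechLinD_apply (n : ℕ) (x : (cechAlg (R := R) R' n).carrier) :
    cechLinD (R := R) R' n x =
      (∑ i : Fin (n + 2), (-1 : ℤ) ^ (i : ℕ) • (cechIns (R := R) R' n i : _ →+* _).toAddMonoidHom) x := by
  simp only [cechLinD, LinearMap.sum_apply, LinearMap.smul_apply, AddMonoidHom.finsetSum_apply,
    AddMonoidHom.coe_smul, Pi.smul_apply]
  refine Finset.sum_congr rfl fun i _ => ?_
  change _ = (-1 : ℤ) ^ (i : ℕ) • cechIns (R := R) R' n i x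
  rcases neg_one_pow_eq_or ℤ (i : ℕ) with h | h <;> rcases Nat.even_or_odd (i : ℕ) with h' | h' <;>
    simp [h'.neg_one_pow]

theorem cechLinD_sq (n : ℕ) : cechLinD (R := R) R' (n + 1) ∘ₗ cechLinD (R := R) R' n = 0 := by
  ext x
  rw [LinearMap.comp_apply, cechLinD_apply, cechLinD_apply]
  exact alt_comp_zero n _ _ (fun i j hij x => DFunLike.congr_fun (cechIns_cosimp R' n i j hij) x) x

theorem cechWittD_sq (p : ℕ) [Fact p.Prime] (n : ℕ) (x) :
    cechWittD (R := R) p R' (n + 1) (cechWittD p R' n x) = 0 := by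
  refine alt_comp_zero n _ _ (fun i j hij x => ?_) x
  ext k
  exact DFunLike.congr_fun (cechIns_cosimp R' n i j hij) (x.coeff k)

theorem gen_exact_zero [Module.FaithfullyFlat R R'] (f : Fin 2 → R' →ₐ[R] R' ⊗[R] R')
    (h0 : f 0 = Algebra.TensorProduct.includeRight)
    (h1 : f 1 = Algebra.TensorProduct.includeLeft)
    (M : Type u) [AddCommGroup M] [Module R M] :
    Function.Exact ((Algebra.linearMap R R').lTensor M)
      ((∑ i : Fin 2, ((-1 : R) ^ (i : ℕ)) • (f i).toLinearMap).lTensor M) := by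
  refine exact_zero R' _ (fun x => ?_) M
  rw [Fin.sum_univ_two, h0, h1]
  simp [sub_eq_add_neg]

theorem gen_exact_succ [Module.FaithfullyFlat R R'] {S : Type u} [CommRing S] [Algebra R S]
    (n : ℕ) (f : Fin (n + 2) → S →ₐ[R] S ⊗[R] R')
    (g : Fin (n + 3) → S ⊗[R] R' →ₐ[R] (S ⊗[R] R') ⊗[R] R')
    (h0 : ∀ i : Fin (n + 2), g i.castSucc = Algebra.TensorProduct.map (f i) (AlgHom.id R R'))
    (h1 : g (Fin.last _) = Algebra.TensorProduct.includeLeft)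
    (h2 : (∑ i : Fin (n + 3), ((-1 : R) ^ (i : ℕ)) • (g i).toLinearMap) ∘ₗ
      (∑ i : Fin (n + 2), ((-1 : R) ^ (i : ℕ)) • (f i).toLinearMap) = 0)
    (M : Type u) [AddCommGroup M] [Module R M] :
    Function.Exact ((∑ i : Fin (n + 2), ((-1 : R) ^ (i : ℕ)) • (f i).toLinearMap).lTensor M)
      ((∑ i : Fin (n + 3), ((-1 : R) ^ (i : ℕ)) • (g i).toLinearMap).lTensor M) := by
  refine exact_succ R' _ _ ((-1 : R) ^ (n + 2)) (by rw [← pow_add, Even.neg_one_pow ⟨_, rfl⟩])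
    ?_ h2 M
  rw [Fin.sum_univ_castSucc]
  simp only [h0, h1, Fin.val_castSucc, Fin.val_last]
  congr 1
  apply TensorProduct.ext'
  intro x y
  rw [LinearMap.rTensor_tmul]
  simp only [LinearMap.sum_apply, LinearMap.smul_apply, TensorProduct.sum_tmul]
  rfl

theorem cechLin_exact_zero [Module.FaithfullyFlat R R'] (M : Type u) [AddCommGroup M] [Module R M] :
    Function.Exact ((Algebra.linearMap R (cechAlg (R := R) R' 0).carrier).lTensor M)
      ((cechLinD (R := R) R' 0).lTensor M) := by
  have key : ∀ (f : Fin 2 → R' →ₐ[R] R' ⊗[R] R')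
    (_ : f 0 = Algebra.TensorProduct.includeRight)
    (_ : f 1 = Algebra.TensorProduct.includeLeft),
    Function.Exact ((Algebra.linearMap R R').lTensor M)
      ((∑ i : Fin 2, ((-1 : R) ^ (i : ℕ)) • (f i).toLinearMap).lTensor M) :=
    fun f h0 h1 => gen_exact_zero R' f h0 h1 M
  exact key (cechIns (R := R) R' 0) rfl rfl

theorem cechLin_exact_succ [Module.FaithfullyFlat R R'] (m : ℕ)
    (M : Type u) [AddCommGroup M] [Module R M] :
    Function.Exact ((cechLinD (R := R) R' m).lTensor M)
      ((cechLinD (R := R) R' (m + 1)).lTensor M) := by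
  have key := gen_exact_succ (R := R) R' (S := (cechAlg (R := R) R' m).carrier) m
    (cechIns (R := R) R' m) (cechIns (R := R) R' (m + 1)) (cechIns_castSucc R' m)
    (cechIns_last R' m) (cechLinD_sq R' m) M
  exact key

theorem cech_flat [Module.Flat R R'] (m : ℕ) : Module.Flat R (cechAlg (R := R) R' m).carrier := by
  induction m with
  | zero => assumption
  | succ m ih =>
    change Module.Flat R ((cechAlg (R := R) R' m).carrier ⊗[R] R')
    infer_instance

end cosimp

section wittStep

theorem coeffHom_apply {p : ℕ} [Fact p.Prime] {S : Type*} [CommRing S] (J K : Ideal S)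
    (h : J ^ 2 ≤ K) (n : ℕ) (x : wIdeal p J) :
    coeffHom p J K h n x = Ideal.Quotient.mk K (x.1.coeff n) := rfl

theorem wIdeal_add_coeff {p : ℕ} [Fact p.Prime] {S : Type*} [CommRing S] (J K : Ideal S)
    (h : J ^ 2 ≤ K) (x y : WittVector p S)
    (hx : x ∈ wIdeal p J) (hy : y ∈ wIdeal p J) (n : ℕ) :
    (x + y).coeff n - (x.coeff n + y.coeff n) ∈ K := by
  rw [← Ideal.Quotient.eq, map_add]
  have := map_add (coeffHom p J K h n) ⟨x, hx⟩ ⟨y, hy⟩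
  simp only [coeffHom_apply] at this
  exact this

theorem wIdeal_sub_coeff {p : ℕ} [Fact p.Prime] {S : Type*} [CommRing S] (J K : Ideal S)
    (h : J ^ 2 ≤ K) (x y : WittVector p S)
    (hx : x ∈ wIdeal p J) (hy : y ∈ wIdeal p J) (n : ℕ) :
    (x - y).coeff n - (x.coeff n - y.coeff n) ∈ K := by
  rw [← Ideal.Quotient.eq, map_sub]
  have := map_sub (coeffHom p J K h n) ⟨x, hx⟩ ⟨y, hy⟩
  simp only [coeffHom_apply] at this
  exact this

theorem wIdeal_neg_coeff {p : ℕ} [Fact p.Prime] {S : Type*} [CommRing S] (J K : Ideal S)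
    (h : J ^ 2 ≤ K) (x : WittVector p S) (hx : x ∈ wIdeal p J) (n : ℕ) :
    (-x).coeff n - (-x.coeff n) ∈ K := by
  rw [← Ideal.Quotient.eq, map_neg]
  have := map_neg (coeffHom p J K h n) ⟨x, hx⟩
  simp only [coeffHom_apply] at this
  exact this

variable {R : Type u} [CommRing R]

theorem map_sq_le {J K : Ideal R} (h : J ^ 2 ≤ K) (B : Type u) [CommRing B] [Algebra R B] :
    (J.map (algebraMap R B)) ^ 2 ≤ K.map (algebraMap R B) := by
  rw [← Ideal.map_pow]; exact Ideal.map_mono h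

theorem map_pow_bot {J : Ideal R} {M : ℕ} (h : J ^ M = ⊥) (B : Type u) [CommRing B] [Algebra R B] :
    (J.map (algebraMap R B)) ^ M = ⊥ := by
  rw [← Ideal.map_pow, h, Ideal.map_bot]

/-- A Witt vector map `D` approximated by a linear map `a`. -/
structure WL (p : ℕ) [Fact p.Prime] {A B : Type u} [CommRing A] [CommRing B] [Algebra R A]
    [Algebra R B] (D : WittVector p A →+ WittVector p B) (a : A →ₗ[R] B) : Prop where
  w : ∀ (J : Ideal R) (x : WittVector p A), x ∈ wIdeal p (J.map (algebraMap R A)) →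
    D x ∈ wIdeal p (J.map (algebraMap R B))
  h : ∀ (J : Ideal R) (M : ℕ) (hJ : J ^ M = ⊥) (x : WittVector p A),
    x ∈ hIdeal p (J.map (algebraMap R A)) M (map_pow_bot hJ A) →
    D x ∈ hIdeal p (J.map (algebraMap R B)) M (map_pow_bot hJ B)
  c : ∀ (J K : Ideal R), J ^ 2 ≤ K → ∀ x : WittVector p A, x ∈ wIdeal p (J.map (algebraMap R A)) →
    ∀ n, (D x).coeff n - a (x.coeff n) ∈ K.map (algebraMap R B)

variable {p : ℕ} [Fact p.Prime] {A B C : Type u} [CommRing A] [CommRing B] [CommRing C]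
  [Algebra R A] [Algebra R B] [Algebra R C]

theorem map_mem_map (J : Ideal R) (f : A →ₐ[R] B) (z : A) (hz : z ∈ J.map (algebraMap R A)) :
    f z ∈ J.map (algebraMap R B) := by
  have := Ideal.mem_map_of_mem (f : A →+* B) hz
  rwa [Ideal.map_map, AlgHom.comp_algebraMap] at this

theorem WL.of_algHom (f : A →ₐ[R] B) :
    WL (R := R) p (WittVector.map (p := p) (f : A →+* B)).toAddMonoidHom f.toLinearMap where
  w J x hx := by
    rw [mem_wIdeal] at hx ⊢
    exact fun n => map_mem_map J f _ (hx n)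
  h J M hJ x hx := by
    rw [mem_hIdeal] at hx ⊢
    obtain ⟨h1, N, hN⟩ := hx
    refine ⟨fun n => map_mem_map J f _ (h1 n), N, fun n hn => ?_⟩
    change f (x.coeff n) = 0
    rw [hN n hn, map_zero]
  c J K h x hx n := by
    change f (x.coeff n) - f (x.coeff n) ∈ _
    rw [sub_self]; exact zero_mem _

theorem WL.zero : WL (R := R) p (0 : WittVector p A →+ WittVector p B) 0 where
  w J x hx := zero_mem _
  h J M hJ x hx := zero_mem _
  c J K h x hx n := by simp

theorem WL.add {D D' : WittVector p A →+ WittVector p B} {a a' : A →ₗ[R] B}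
    (h : WL p D a) (h' : WL p D' a') : WL p (D + D') (a + a') where
  w J x hx := add_mem (h.w J x hx) (h'.w J x hx)
  h J M hJ x hx := add_mem (h.h J M hJ x hx) (h'.h J M hJ x hx)
  c J K hJK x hx n := by
    have h1 := h.c J K hJK x hx n
    have h2 := h'.c J K hJK x hx n
    have h3 := wIdeal_add_coeff _ _ (map_sq_le hJK B) _ _ (h.w J x hx) (h'.w J x hx) n
    have := add_mem (add_mem h1 h2) h3
    rw [AddMonoidHom.add_apply, LinearMap.add_apply]
    convert this using 1
    ring

theorem WL.neg {D : WittVector p A →+ WittVector p B} {a : A →ₗ[R] B}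
    (h : WL p D a) : WL p (-D) (-a) where
  w J x hx := neg_mem (h.w J x hx)
  h J M hJ x hx := neg_mem (h.h J M hJ x hx)
  c J K hJK x hx n := by
    have h1 := h.c J K hJK x hx n
    have h3 := wIdeal_neg_coeff _ _ (map_sq_le hJK B) _ (h.w J x hx) n
    have := sub_mem h3 h1
    rw [AddMonoidHom.neg_apply, LinearMap.neg_apply]
    convert this using 1
    ring

theorem WL.pow {D : WittVector p A →+ WittVector p B} {a : A →ₗ[R] B}
    (h : WL p D a) (k : ℕ) : WL p ((-1 : ℤ) ^ k • D) ((-1 : R) ^ k • a) := by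
  rcases Nat.even_or_odd k with hk | hk
  · rw [hk.neg_one_pow, hk.neg_one_pow, one_smul, one_smul]; exact h
  · have h1 : (-1 : R) • a = -a := by ext; simp
    rw [hk.neg_one_pow, hk.neg_one_pow, neg_smul, one_smul, h1]; exact h.neg

theorem WL.sum {ι : Type*} (s : Finset ι) (D : ι → (WittVector p A →+ WittVector p B))
    (a : ι → (A →ₗ[R] B)) (h : ∀ i, WL p (D i) (a i)) : WL p (∑ i ∈ s, D i) (∑ i ∈ s, a i) := by
  classical
  induction s using Finset.induction_on with
  | empty => simpa using WL.zero
  | insert i s hi ih => rw [Finset.sum_insert hi, Finset.sum_insert hi]; exact (h i).add ih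

theorem mem_smul_top_iff (I : Ideal R) (z : A) :
    z ∈ I • (⊤ : Submodule R A) ↔ z ∈ I.map (algebraMap R A) := by
  rw [Ideal.smul_top_eq_map]; rfl

theorem witt_step [Module.Flat R B] [Module.Flat R C]
    {DA : WittVector p A →+ WittVector p B} {a : A →ₗ[R] B} (hA : WL p DA a)
    {DB : WittVector p B →+ WittVector p C} {b : B →ₗ[R] C} (hB : WL p DB b)
    (hex : ∀ (M : Type u) [AddCommGroup M] [Module R M],
      Function.Exact (a.lTensor M) (b.lTensor M))
    (hDD : ∀ y, DB (DA y) = 0) (I : Ideal R) (M : ℕ) (hI : I ^ M = ⊥) (x : WittVector p B)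
    (hx : x ∈ hIdeal p (I.map (algebraMap R B)) M (map_pow_bot hI B)) (hDx : DB x = 0) (k : ℕ) :
    ∃ y ∈ hIdeal p (I.map (algebraMap R A)) M (map_pow_bot hI A),
      x - DA y ∈ wIdeal p ((I ^ (k + 1)).map (algebraMap R B)) := by
  induction k with
  | zero =>
    refine ⟨0, zero_mem _, ?_⟩
    rw [map_zero, sub_zero, zero_add, pow_one, mem_wIdeal]
    exact ((mem_hIdeal _ _ _ _).1 hx).1
  | succ k ih =>
    obtain ⟨y, hy, hxy⟩ := ih
    set x' := x - DA y with hx'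
    have hx'h : x' ∈ hIdeal p (I.map (algebraMap R B)) M (map_pow_bot hI B) :=
      sub_mem hx (hA.h I M hI y hy)
    have hDx' : DB x' = 0 := by rw [hx', map_sub, hDx, hDD, sub_zero]
    have hJK : (I ^ (k + 1)) ^ 2 ≤ I ^ (k + 1 + 1) := by
      rw [← pow_mul]; exact Ideal.pow_le_pow_right (by lia)
    have hle : I ^ (k + 1 + 1) ≤ I ^ (k + 1) := Ideal.pow_le_pow_right (by lia)
    have hc := hB.c _ _ hJK x' hxy
    have hstep : ∀ n, ∃ z, (z ∈ (I ^ (k + 1)).map (algebraMap R A) ∧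
        x'.coeff n - a z ∈ (I ^ (k + 1 + 1)).map (algebraMap R B)) ∧ (x'.coeff n = 0 → z = 0) := by
      intro n
      by_cases hn : x'.coeff n = 0
      · exact ⟨0, ⟨zero_mem _, by rw [hn, map_zero, sub_zero]; exact zero_mem _⟩, fun _ => rfl⟩
      · have h1 := hc n
        rw [hDx', WittVector.zero_coeff, zero_sub, neg_mem_iff, ← mem_smul_top_iff] at h1
        obtain ⟨z, hz1, hz2⟩ := flat_step a b hex _ _ hle (x'.coeff n)
          ((mem_smul_top_iff _ _).2 ((mem_wIdeal _ _).1 hxy n)) h1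
        exact ⟨z, ⟨(mem_smul_top_iff _ _).1 hz1, (mem_smul_top_iff _ _).1 hz2⟩, fun h => absurd h hn⟩
    choose z hz hz0 using hstep
    let y' : WittVector p A := WittVector.mk p z
    have hy'w : y' ∈ wIdeal p ((I ^ (k + 1)).map (algebraMap R A)) :=
      (mem_wIdeal _ _).2 fun n => (hz n).1
    have hy'h : y' ∈ hIdeal p (I.map (algebraMap R A)) M (map_pow_bot hI A) := by
      rw [mem_hIdeal]
      obtain ⟨_, N, hN⟩ := (mem_hIdeal _ _ _ _).1 hx'h
      refine ⟨fun n => Ideal.map_mono (Ideal.pow_le_self (by lia)) (hz n).1, N, fun n hn => ?_⟩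
      exact hz0 n (hN n hn)
    refine ⟨y + y', add_mem hy hy'h, ?_⟩
    have e : x - DA (y + y') = x' - DA y' := by rw [map_add, hx']; abel
    rw [e, mem_wIdeal]
    intro n
    have h1 := wIdeal_sub_coeff _ _ (map_sq_le hJK B) _ _ hxy (hA.w _ _ hy'w) n
    have h2 := hA.c _ _ hJK y' hy'w n
    have h3 := (hz n).2
    have h4 : x'.coeff n - a (y'.coeff n) ∈ (I ^ (k + 1 + 1)).map (algebraMap R B) := h3
    have := sub_mem (add_mem h1 h4) h2
    convert this using 1
    ring

theorem IsHatW.exists_ideal (hB : RedPres R B) (x : WittVector p B) (hx : IsHatW p x) :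
    ∃ (I : Ideal R) (M : ℕ) (hI : I ^ M = ⊥),
      x ∈ hIdeal p (I.map (algebraMap R B)) M (map_pow_bot hI B) := by
  obtain ⟨h1, N, hN⟩ := hx
  have key : ∀ z : B, z ∈ (nilradical R).map (algebraMap R B) →
      ∃ I : Ideal R, I.FG ∧ I ≤ nilradical R ∧ z ∈ I.map (algebraMap R B) := by
    intro z hz
    rw [← mem_smul_top_iff] at hz
    refine Submodule.smul_induction_on hz ?_ ?_
    · intro r hr x _
      refine ⟨Ideal.span {r}, ⟨{r}, by simp⟩, ?_, ?_⟩
      · rwa [Ideal.span_singleton_le_iff_mem]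
      · rw [← mem_smul_top_iff]
        exact Submodule.smul_mem_smul (Ideal.mem_span_singleton_self r) trivial
    · rintro x y ⟨I, hI, hI', hx⟩ ⟨J, hJ, hJ', hy⟩
      exact ⟨I ⊔ J, Submodule.FG.sup hI hJ, sup_le hI' hJ',
        add_mem (Ideal.map_mono le_sup_left hx) (Ideal.map_mono le_sup_right hy)⟩
  choose I hI hI' hxI using fun n => key _ (hB.nil _ (h1 n))
  have hfg : ((Finset.range N).sup I).FG := Submodule.fg_finset_sup _ _ (fun i _ => hI i)
  have hnil : (Finset.range N).sup I ≤ nilradical R := Finset.sup_le fun i _ => hI' i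
  have hn : IsNilpotent ((Finset.range N).sup I) := (hfg.isNilpotent_iff_le_nilradical).2 hnil
  obtain ⟨M, hM⟩ := hn
  refine ⟨_, M, hM, ?_⟩
  rw [mem_hIdeal]
  refine ⟨fun n => ?_, N, hN⟩
  by_cases hnN : n < N
  · exact Ideal.map_mono (Finset.le_sup (f := I) (Finset.mem_range.2 hnN)) (hxI n)
  · rw [hN n (not_lt.1 hnN)]; exact zero_mem _

theorem IsHatW.of_hIdeal {S : Type u} [CommRing S] (J : Ideal S) (M : ℕ) (hJ : J ^ M = ⊥)
    (x : WittVector p S) (hx : x ∈ hIdeal p J M hJ) : IsHatW p x := by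
  rw [mem_hIdeal] at hx
  refine ⟨fun n => ⟨M, ?_⟩, hx.2⟩
  have := Ideal.pow_mem_pow (hx.1 n) M
  rwa [hJ] at this

theorem witt_exact [Module.Flat R B] [Module.Flat R C] (hR : RedPres R B)
    {DA : WittVector p A →+ WittVector p B} {a : A →ₗ[R] B} (hA : WL p DA a)
    {DB : WittVector p B →+ WittVector p C} {b : B →ₗ[R] C} (hB : WL p DB b)
    (hex : ∀ (M : Type u) [AddCommGroup M] [Module R M],
      Function.Exact (a.lTensor M) (b.lTensor M))
    (hDD : ∀ y, DB (DA y) = 0) (x : WittVector p B) (hx : IsHatW p x) :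
    DB x = 0 ↔ ∃ y, IsHatW p y ∧ DA y = x := by
  constructor
  · intro h
    obtain ⟨I, M, hI, hxI⟩ := hx.exists_ideal hR
    obtain ⟨y, hy, hxy⟩ := witt_step hA hB hex hDD I M hI x hxI h M
    refine ⟨y, IsHatW.of_hIdeal _ _ _ _ hy, ?_⟩
    have h0 : I ^ (M + 1) = ⊥ := by rw [pow_succ, hI, Ideal.bot_mul]
    rw [h0, Ideal.map_bot, mem_wIdeal] at hxy
    symm
    rw [← sub_eq_zero]
    ext n
    simpa using hxy n
  · rintro ⟨y, _, rfl⟩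
    exact hDD y

theorem WL.cech (R' : Type u) [CommRing R'] [Algebra R R'] (m : ℕ) :
    WL p (cechWittD (R := R) p R' m) (cechLinD (R := R) R' m) :=
  WL.sum _ _ _ fun i => (WL.of_algHom (cechIns (R := R) R' m i)).pow i

theorem WL.algebraMap :
    WL (R := R) p (WittVector.map (p := p) (algebraMap R A)).toAddMonoidHom (Algebra.linearMap R A) :=
  WL.of_algHom (Algebra.ofId R A)

end wittStep

theorem hatW_cech_acyclic_of_indEtale (p : ℕ) [Fact p.Prime]
    (R R' : Type u) [CommRing R] [CommRing R'] [Algebra R R']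
    (hp : IsNilpotent (p : R))
    [Module.FaithfullyFlat R R'] (hie : IsIndEtale R R') :
    -- the maps of the complex preserve the subgroups `Ŵ(-)`
    (∀ x : WittVector p R, IsHatW p x →
        IsHatW p (WittVector.map (algebraMap R R') x)) ∧
    (∀ (m : ℕ) (x : WittVector p (cechAlg (R := R) R' m).carrier), IsHatW p x →
        IsHatW p (cechWittD p R' m x)) ∧
    -- exactness at the augmentation term
    (∀ x : WittVector p R, IsHatW p x →
        WittVector.map (algebraMap R R') x = 0 → x = 0) ∧
    -- exactness at the degree 0 term
    (∀ x : WittVector p (cechAlg (R := R) R' 0).carrier, IsHatW p x →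
        (cechWittD p R' 0 x = 0 ↔
          ∃ y : WittVector p R, IsHatW p y ∧
            WittVector.map (algebraMap R R') y = x)) ∧
    -- exactness at the higher terms
    (∀ (m : ℕ) (x : WittVector p (cechAlg (R := R) R' (m + 1)).carrier),
        IsHatW p x →
        (cechWittD p R' (m + 1) x = 0 ↔
          ∃ y, IsHatW p y ∧ cechWittD p R' m y = x)) := by
  obtain ⟨E⟩ := hie
  have hred : RedPres R R' := RedPres.of_indEtale E
  have hflat := cech_flat (R := R) R'
  refine ⟨?_, ?_, ?_, ?_, ?_⟩
  · rintro x ⟨h1, N, hN⟩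
    refine ⟨fun n => ?_, N, fun n hn => ?_⟩
    · rw [WittVector.map_coeff]; exact (h1 n).map _
    · rw [WittVector.map_coeff, hN n hn, map_zero]
  · intro m x hx
    obtain ⟨I, M, hI, hxI⟩ := hx.exists_ideal (hred.cech m)
    exact IsHatW.of_hIdeal _ _ _ _ ((WL.cech R' m).h I M hI x hxI)
  · intro x _ h
    ext n
    have h1 : algebraMap R R' (x.coeff n) = 0 := by
      rw [← WittVector.map_coeff, h, WittVector.zero_coeff]
    rw [WittVector.zero_coeff]
    exact (FaithfulSMul.algebraMap_injective R R') (h1.trans (map_zero _).symm)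
  · intro x hx
    have := hflat 0
    have := hflat 1
    refine witt_exact (R := R) (hred.cech 0) WL.algebraMap (WL.cech R' 0)
      (fun M _ _ => cechLin_exact_zero R' M) ?_ x hx
    intro y
    have h0 : ∀ z : WittVector p (cechAlg (R := R) R' 0).carrier, cechWittD (R := R) p R' 0 z =
        WittVector.map (cechIns (R := R) R' 0 0 : _ →+* _) z -
          WittVector.map (cechIns (R := R) R' 0 1 : _ →+* _) z := by
      intro z
      rw [cechWittD, Fin.sum_univ_two]
      simp [sub_eq_add_neg]
    rw [h0, sub_eq_zero]
    ext n
    exact ((cechIns (R := R) R' 0 0).commutes (y.coeff n)).trans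
      ((cechIns (R := R) R' 0 1).commutes (y.coeff n)).symm
  · intro m x hx
    have := hflat (m + 1)
    have := hflat (m + 2)
    exact witt_exact (R := R) (hred.cech (m + 1)) (WL.cech R' m) (WL.cech R' (m + 1))
      (fun M _ _ => cechLin_exact_succ R' m M) (cechWittD_sq R' p m) x hx
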